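/- A point x = (x_1,…,x_N) ∈ (ℝ^d)^N satisfies the fixed-point equations x_i = (I + Σ_{j≠i} w_{ij})⁻¹ (z_i + Σ_{j≠i} w_{ij} x_j) for every i if and only if x is the unique global minimizer of E; i.e., the fixed points of the message-passing (coordinate-descent) updates are exactly the global minimizer of the quadratic energy. -/

import Mathlib

open Matrix Finset

/-- The continuous quadratic energy of the point cloud features:
`E(x) = Σ_i ‖x_i − z_i‖² + (1/2) Σ_{i≠j} (x_i − x_j)ᵀ w_{ij} (x_i − x_j)`. -/
noncomputable def energy {N d : ℕ} (z : Fin N → Fin d → ℝ)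
    (w : Fin N → Fin N → Matrix (Fin d) (Fin d) ℝ)
    (x : Fin N → Fin d → ℝ) : ℝ :=
  ∑ i, (x i - z i) ⬝ᵥ (x i - z i) +
    (1 / 2 : ℝ) * ∑ i, ∑ j ∈ univ.erase i, (x i - x j) ⬝ᵥ (w i j) *ᵥ (x i - x j)

/-- The linear part of the half-gradient of the energy. -/
noncomputable def gradLin {N d : ℕ} (w : Fin N → Fin N → Matrix (Fin d) (Fin d) ℝ) :
    (Fin N → Fin d → ℝ) →ₗ[ℝ] (Fin N → Fin d → ℝ) where
  toFun x := fun i => x i + ∑ j, w i j *ᵥ (x i - x j)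
  map_add' x y := by
    funext i
    have : ∀ j, w i j *ᵥ ((x + y) i - (x + y) j)
        = w i j *ᵥ (x i - x j) + w i j *ᵥ (y i - y j) := by
      intro j
      rw [← mulVec_add]; congr 1; simp only [Pi.add_apply]; abel
    simp only [this, sum_add_distrib]
    simp only [Pi.add_apply]; abel
  map_smul' c x := by
    funext i
    have : ∀ j, w i j *ᵥ ((c • x) i - (c • x) j) = c • (w i j *ᵥ (x i - x j)) := by
      intro j
      rw [← mulVec_smul]; congr 1; simp only [Pi.smul_apply, smul_sub]
    simp only [this, ← smul_sum]
    simp only [RingHom.id_apply, Pi.smul_apply, smul_add]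

theorem gradLin_apply {N d : ℕ} (w : Fin N → Fin N → Matrix (Fin d) (Fin d) ℝ)
    (x : Fin N → Fin d → ℝ) (i : Fin N) :
    gradLin w x i = x i + ∑ j, w i j *ᵥ (x i - x j) := rfl

theorem energy_eq {N d : ℕ} (z : Fin N → Fin d → ℝ)
    (w : Fin N → Fin N → Matrix (Fin d) (Fin d) ℝ) (x : Fin N → Fin d → ℝ) :
    energy z w x = ∑ i, (x i - z i) ⬝ᵥ (x i - z i) +
    (1 / 2 : ℝ) * ∑ i, ∑ j, (x i - x j) ⬝ᵥ (w i j) *ᵥ (x i - x j) := by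
  unfold energy
  congr 2
  refine sum_congr rfl fun i _ => ?_
  exact sum_erase _ (by simp)

theorem dot_gradLin {N d : ℕ} (w : Fin N → Fin N → Matrix (Fin d) (Fin d) ℝ)
    (hsymm : ∀ i j, w i j = w j i) (h k : Fin N → Fin d → ℝ) :
    ∑ i, h i ⬝ᵥ gradLin w k i = ∑ i, h i ⬝ᵥ k i +
      (1 / 2 : ℝ) * ∑ i, ∑ j, (h i - h j) ⬝ᵥ (w i j) *ᵥ (k i - k j) := by
  have e : ∑ i, ∑ j, h j ⬝ᵥ (w i j) *ᵥ (k i - k j)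
      = - ∑ i, ∑ j, h i ⬝ᵥ (w i j) *ᵥ (k i - k j) := by
    rw [sum_comm, ← sum_neg_distrib]
    refine sum_congr rfl fun i _ => ?_
    rw [← sum_neg_distrib]
    refine sum_congr rfl fun j _ => ?_
    rw [hsymm j i, ← dotProduct_neg, ← mulVec_neg, neg_sub]
  simp only [sub_dotProduct, sum_sub_distrib, e, gradLin_apply, dotProduct_add,
    dotProduct_sum, sum_add_distrib]
  ring

theorem energy_add {N d : ℕ} (z : Fin N → Fin d → ℝ)
    (w : Fin N → Fin N → Matrix (Fin d) (Fin d) ℝ)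
    (hpsd : ∀ i j, i ≠ j → (w i j).PosSemidef)
    (hsymm : ∀ i j, w i j = w j i) (x h : Fin N → Fin d → ℝ) :
    energy z w (x + h) = energy z w x + 2 * ∑ i, h i ⬝ᵥ (gradLin w x - z) i
      + ∑ i, h i ⬝ᵥ gradLin w h i := by
  have e1 : ∀ i, ((x + h) i - z i) ⬝ᵥ ((x + h) i - z i) =
      (x i - z i) ⬝ᵥ (x i - z i) + 2 * (h i ⬝ᵥ x i - h i ⬝ᵥ z i) + h i ⬝ᵥ h i := by
    intro i
    simp only [Pi.add_apply, add_dotProduct, sub_dotProduct, dotProduct_add, dotProduct_sub]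
    rw [dotProduct_comm (x i) (h i), dotProduct_comm (z i) (h i)]
    ring
  have e2 : ∀ i j, ((x + h) i - (x + h) j) ⬝ᵥ (w i j) *ᵥ ((x + h) i - (x + h) j) =
      (x i - x j) ⬝ᵥ (w i j) *ᵥ (x i - x j) + 2 * ((h i - h j) ⬝ᵥ (w i j) *ᵥ (x i - x j))
       + (h i - h j) ⬝ᵥ (w i j) *ᵥ (h i - h j) := by
    intro i j
    by_cases hij : i = j
    · subst hij; simp
    have ht : (w i j)ᵀ = w i j := by
      have := (hpsd i j hij).isHermitian
      simpa [IsHermitian, conjTranspose_eq_transpose_of_trivial] using this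
    have : (x + h) i - (x + h) j = (x i - x j) + (h i - h j) := by
      simp only [Pi.add_apply]; abel
    rw [this]
    generalize x i - x j = a
    generalize h i - h j = b
    have hs : a ⬝ᵥ (w i j) *ᵥ b = b ⬝ᵥ (w i j) *ᵥ a := by
      rw [dotProduct_mulVec, dotProduct_comm, ← mulVec_transpose, ht]
    rw [mulVec_add, add_dotProduct, dotProduct_add, dotProduct_add, hs]
    ring
  simp only [energy_eq, e1, e2, Pi.sub_apply, dotProduct_sub, sum_sub_distrib,
    dot_gradLin w hsymm, sum_add_distrib, ← mul_sum]
  simp only [sub_dotProduct, dotProduct_sub, sum_sub_distrib]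
  ring

theorem quad_ge {N d : ℕ} (w : Fin N → Fin N → Matrix (Fin d) (Fin d) ℝ)
    (hpsd : ∀ i j, i ≠ j → (w i j).PosSemidef)
    (hsymm : ∀ i j, w i j = w j i) (h : Fin N → Fin d → ℝ) :
    ∑ i, h i ⬝ᵥ h i ≤ ∑ i, h i ⬝ᵥ gradLin w h i := by
  rw [dot_gradLin w hsymm]
  have : 0 ≤ ∑ i, ∑ j, (h i - h j) ⬝ᵥ (w i j) *ᵥ (h i - h j) := by
    refine sum_nonneg fun i _ => sum_nonneg fun j _ => ?_
    by_cases hij : i = j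
    · subst hij; simp
    simpa using (hpsd i j hij).dotProduct_mulVec_nonneg (h i - h j)
  linarith

theorem sum_sq_nonneg {N d : ℕ} (h : Fin N → Fin d → ℝ) : 0 ≤ ∑ i, h i ⬝ᵥ h i :=
  sum_nonneg fun i _ => sum_nonneg fun j _ => mul_self_nonneg _

theorem eq_zero_of_sum_sq {N d : ℕ} (h : Fin N → Fin d → ℝ) (h0 : ∑ i, h i ⬝ᵥ h i ≤ 0) :
    h = 0 := by
  have := (sum_eq_zero_iff_of_nonneg (s := univ) (f := fun i => h i ⬝ᵥ h i)
    (fun i _ => sum_nonneg fun j _ => mul_self_nonneg _)).1 (le_antisymm h0 (sum_sq_nonneg h))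
  funext i
  exact dotProduct_self_eq_zero.1 (this i (mem_univ i))

theorem gradLin_injective {N d : ℕ} (w : Fin N → Fin N → Matrix (Fin d) (Fin d) ℝ)
    (hpsd : ∀ i j, i ≠ j → (w i j).PosSemidef)
    (hsymm : ∀ i j, w i j = w j i) : Function.Injective (gradLin w) := by
  rw [injective_iff_map_eq_zero]
  intro h hh
  apply eq_zero_of_sum_sq
  have := quad_ge w hpsd hsymm h
  simpa [hh] using this

theorem min_iff {N d : ℕ} (z : Fin N → Fin d → ℝ)
    (w : Fin N → Fin N → Matrix (Fin d) (Fin d) ℝ)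
    (hpsd : ∀ i j, i ≠ j → (w i j).PosSemidef)
    (hsymm : ∀ i j, w i j = w j i) (x : Fin N → Fin d → ℝ) :
    (∀ y, energy z w x ≤ energy z w y) ↔ gradLin w x = z := by
  constructor
  · intro hmin
    rw [← sub_eq_zero]
    set g := gradLin w x - z with hg
    apply eq_zero_of_sum_sq
    set Q := ∑ i, g i ⬝ᵥ gradLin w g i with hQ
    set S := ∑ i, g i ⬝ᵥ g i with hS
    have key : ∀ t : ℝ, 0 ≤ 2 * (t * S) + t * t * Q := by
      intro t
      have h1 := hmin (x + t • g)
      rw [energy_add z w hpsd hsymm, ← hg] at h1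
      simp only [map_smul, Pi.smul_apply, smul_dotProduct, dotProduct_smul, smul_eq_mul,
        ← mul_sum] at h1
      rw [← hQ, ← hS] at h1
      linarith
    have hSQ : S ≤ Q := quad_ge w hpsd hsymm g
    by_contra hlt
    push Not at hlt
    have hQp : 0 < Q := by linarith
    have := key (-(S / Q))
    have e : 2 * (-(S / Q) * S) + -(S / Q) * -(S / Q) * Q = -(S * S / Q) := by
      field_simp; ring
    rw [e] at this
    have : 0 < S * S / Q := by positivity
    linarith
  · intro hx y
    have := energy_add z w hpsd hsymm x (y - x)
    rw [add_sub_cancel, hx] at this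
    have h2 := quad_ge w hpsd hsymm (y - x)
    have h3 := sum_sq_nonneg (y - x)
    simp only [sub_self, Pi.zero_apply, dotProduct_zero, sum_const_zero, mul_zero] at this
    linarith

theorem fixed_iff {N d : ℕ} (z : Fin N → Fin d → ℝ)
    (w : Fin N → Fin N → Matrix (Fin d) (Fin d) ℝ)
    (hpsd : ∀ i j, i ≠ j → (w i j).PosSemidef) (x : Fin N → Fin d → ℝ) :
    (∀ i, x i = (1 + ∑ j ∈ univ.erase i, w i j)⁻¹ *ᵥ
          (z i + ∑ j ∈ univ.erase i, (w i j) *ᵥ x j)) ↔ gradLin w x = z := by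
  rw [funext_iff]
  refine forall_congr' fun i => ?_
  have hP : (1 + ∑ j ∈ univ.erase i, w i j).PosDef := by
    apply PosDef.one.add_posSemidef
    exact posSemidef_sum _ fun j hj => hpsd i j (ne_of_mem_erase hj).symm
  have hu : IsUnit (1 + ∑ j ∈ univ.erase i, w i j).det := hP.det_pos.ne'.isUnit
  have hg : gradLin w x i = (1 + ∑ j ∈ univ.erase i, w i j) *ᵥ x i
      - ∑ j ∈ univ.erase i, (w i j) *ᵥ x j := by
    rw [gradLin_apply, ← sum_erase (a := i) univ (by simp), add_mulVec, one_mulVec, sum_mulVec]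
    simp only [mulVec_sub, sum_sub_distrib]
    abel
  rw [hg, sub_eq_iff_eq_add]
  constructor
  · intro h
    rw [h, mulVec_mulVec, mul_nonsing_inv _ hu, one_mulVec]
  · intro h
    rw [← h, mulVec_mulVec, nonsing_inv_mul _ hu, one_mulVec]

/-- `E` has a unique global minimizer, and a point `x` satisfies the fixed-point
equations `x_i = (I + Σ_{j≠i} w_{ij})⁻¹ (z_i + Σ_{j≠i} w_{ij} x_j)` for every `i`
if and only if `x` is a global minimizer of `E`: the fixed points of the
message-passing (coordinate-descent) updates are exactly the global minimizer. -/
theorem stmt_6 {N d : ℕ} (hN : 0 < N) (hd : 0 < d)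
    (z : Fin N → Fin d → ℝ)
    (w : Fin N → Fin N → Matrix (Fin d) (Fin d) ℝ)
    (hpsd : ∀ i j, i ≠ j → (w i j).PosSemidef)
    (hsymm : ∀ i j, w i j = w j i) :
    (∃! xs : Fin N → Fin d → ℝ, ∀ y, energy z w xs ≤ energy z w y) ∧
    (∀ x : Fin N → Fin d → ℝ,
      (∀ i, x i = (1 + ∑ j ∈ univ.erase i, w i j)⁻¹ *ᵥ
          (z i + ∑ j ∈ univ.erase i, (w i j) *ᵥ x j)) ↔
      (∀ y, energy z w x ≤ energy z w y)) := by
  refine ⟨?_, fun x => (fixed_iff z w hpsd x).trans (min_iff z w hpsd hsymm x).symm⟩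
  have hinj := gradLin_injective w hpsd hsymm
  obtain ⟨xs, hxs⟩ := LinearMap.injective_iff_surjective.1 hinj z
  refine ⟨xs, (min_iff z w hpsd hsymm xs).2 hxs, fun y hy => hinj ?_⟩
  rw [hxs]
  exact (min_iff z w hpsd hsymm y).1 hy
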